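/- Let S ≤ S' be additive submonoids of ℕ with S ≠ S', the pair (S, S') equi-gcd, and S irreducible in S'. If Nat.card (PF(S'/S)) = 1 (Cohen–Macaulay type one) then Nat.card (G(S'/S)) = Nat.card (N(S'/S)); if Nat.card (PF(S'/S)) = 2 (Cohen–Macaulay type two) then Nat.card (G(S'/S)) = Nat.card (N(S'/S)) + 1. -/

import Mathlib

/-- The pair `(S, S')` is equi-gcd: a natural number divides every element of `S`
iff it divides every element of `S'`. -/
def EquiGcd (S S' : AddSubmonoid ℕ) : Prop :=
  ∀ d : ℕ, (∀ x ∈ S, d ∣ x) ↔ (∀ x ∈ S', d ∣ x)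

/-- The gap set `G(S'/S) = S' \ S`. -/
def gapSet (S S' : AddSubmonoid ℕ) : Set ℕ := (S' : Set ℕ) \ (S : Set ℕ)

/-- The sporadic set `N(S'/S)` of elements of `S` not in the conductor. -/
def sporadicSet (S S' : AddSubmonoid ℕ) : Set ℕ :=
  {a : ℕ | a ∈ S ∧ ∃ t ∈ S', a + t ∉ S}

/-- The pseudo-Frobenius set `PF(S'/S)`. -/
def pseudoFrobSet (S S' : AddSubmonoid ℕ) : Set ℕ :=
  {w : ℕ | w ∈ S' ∧ w ∉ S ∧ ∀ s ∈ S, s ≠ 0 → w + s ∈ S}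

/-- The Frobenius set `F(S'/S)`. -/
def frobSet (S S' : AddSubmonoid ℕ) : Set ℕ :=
  {w : ℕ | w ∈ S' ∧ w ∉ S ∧ ∀ t ∈ S', t ≠ 0 → w + t ∈ S}

/-- `S` is irreducible in `S'`. -/
def IrreducibleIn (S S' : AddSubmonoid ℕ) : Prop :=
  ∀ T₁ T₂ : AddSubmonoid ℕ, S ≤ T₁ → T₁ ≤ S' → S ≤ T₂ → T₂ ≤ S' →
    T₁ ⊓ T₂ = S → T₁ = S ∨ T₂ = S

/-- The fundamental gap set `FG(S'/S)`. -/
def fundGapSet (S S' : AddSubmonoid ℕ) : Set ℕ :=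
  {t : ℕ | t ∈ S' ∧ t ∉ S ∧ 2 * t ∈ S ∧ 3 * t ∈ S}

theorem finite_gapSet {S S' : AddSubmonoid ℕ} (hgcd : EquiGcd S S') :
    (gapSet S S').Finite := by
  obtain ⟨n, hn⟩ := Nat.exists_mem_closure_of_ge (S : Set ℕ)
  refine (Set.finite_lt_nat n).subset fun x hx => ?_
  by_contra hlt
  refine hx.2 ?_
  rw [← AddSubmonoid.closure_eq S]
  exact hn x (not_lt.mp hlt)
    ((hgcd _).1 (fun y hy => Nat.setGcd_dvd_of_mem hy) x hx.1)

/-- Every gap lies below a pseudo-Frobenius element for the order induced by `S`. -/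
theorem exists_add_mem_pseudoFrobSet {S S' : AddSubmonoid ℕ} (hSS' : S ≤ S')
    (hfin : (gapSet S S').Finite) {g : ℕ} (hg : g ∈ gapSet S S') :
    ∃ s ∈ S, g + s ∈ pseudoFrobSet S S' := by
  have hA : {x ∈ gapSet S S' | ∃ s ∈ S, g + s = x}.Finite := hfin.subset (Set.sep_subset _ _)
  obtain ⟨x, ⟨hx, s, hs, rfl⟩, hmax⟩ :=
    Set.exists_max_image _ id hA ⟨g, hg, 0, S.zero_mem, add_zero g⟩
  refine ⟨s, hs, hx.1, hx.2, fun r hr hr0 => ?_⟩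
  by_contra hnot
  have := hmax (g + s + r)
    ⟨⟨S'.add_mem hx.1 (hSS' hr), hnot⟩, s + r, S.add_mem hs hr, (add_assoc g s r).symm⟩
  simp only [id] at this
  omega

/-- If `F ∉ S`, reflection in `F` matches the gaps `g` with `F - g ∈ S` with the sporadic
elements, provided that every sporadic element has its reflection in `S'`. -/
theorem ncard_sep_gapSet_eq_ncard_sporadicSet {S S' : AddSubmonoid ℕ} {F : ℕ} (hF : F ∉ S)
    (hN : ∀ a ∈ sporadicSet S S', ∃ t ∈ S', a + t = F) :
    {g ∈ gapSet S S' | ∃ s ∈ S, g + s = F}.ncard = (sporadicSet S S').ncard := by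
  refine Set.ncard_congr (fun g _ => F - g) ?_ ?_ ?_
  · rintro g ⟨hg, s, hs, rfl⟩
    rw [Nat.add_sub_cancel_left]
    exact ⟨hs, g, hg.1, by rwa [add_comm]⟩
  · rintro g h ⟨-, s, -, hs⟩ ⟨-, r, -, hr⟩ heq
    omega
  · intro a ha
    obtain ⟨t, ht, rfl⟩ := hN a ha
    exact ⟨t, ⟨⟨ht, fun htS => hF (S.add_mem ha.1 htS)⟩, a, ha.1, add_comm t a⟩,
      Nat.add_sub_cancel a t⟩

/-- Adjoining to `S` a pseudo-Frobenius element whose double lies in `S`. -/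
def adjoinPseudoFrob {S S' : AddSubmonoid ℕ} {w : ℕ} (hw : w ∈ pseudoFrobSet S S')
    (h2 : w + w ∈ S) : AddSubmonoid ℕ where
  carrier := insert w (S : Set ℕ)
  zero_mem' := Or.inr S.zero_mem
  add_mem' := by
    have key : ∀ s ∈ S, w + s ∈ insert w (S : Set ℕ) := fun s hs => by
      rcases eq_or_ne s 0 with rfl | h0
      · exact Or.inl (add_zero w)
      · exact Or.inr (hw.2.2 s hs h0)
    rintro a b (rfl | ha) (rfl | hb)
    · exact Or.inr h2
    · exact key b hb
    · rw [add_comm]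
      exact key a ha
    · exact Or.inr (S.add_mem ha hb)

theorem IrreducibleIn.eq_of_mem_pseudoFrobSet {S S' : AddSubmonoid ℕ} (hSS' : S ≤ S')
    (hirr : IrreducibleIn S S') {v w : ℕ} (hv : v ∈ pseudoFrobSet S S')
    (hw : w ∈ pseudoFrobSet S S') (hv2 : v + v ∈ S) (hw2 : w + w ∈ S) : v = w := by
  by_contra hne
  have hle : ∀ {u : ℕ} (hu : u ∈ pseudoFrobSet S S') (h2 : u + u ∈ S),
      S ≤ adjoinPseudoFrob hu h2 ∧ adjoinPseudoFrob hu h2 ≤ S' ∧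
        adjoinPseudoFrob hu h2 ≠ S := by
    refine fun {u} hu h2 => ⟨fun x hx => Or.inr hx, ?_, fun h => hu.2.1 ?_⟩
    · rintro x (rfl | hx)
      exacts [hu.1, hSS' hx]
    · rw [← h]
      exact Or.inl rfl
  obtain ⟨hv₁, hv₂, hv₃⟩ := hle hv hv2
  obtain ⟨hw₁, hw₂, hw₃⟩ := hle hw hw2
  refine (hirr _ _ hv₁ hv₂ hw₁ hw₂ (le_antisymm ?_ (le_inf hv₁ hw₁))).elim hv₃ hw₃
  rintro x ⟨rfl | hx, rfl | hx'⟩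
  exacts [(hne rfl).elim, hx', hx, hx]

theorem add_self_mem_pseudoFrobSet {S S' : AddSubmonoid ℕ} {w : ℕ}
    (hw : w ∈ pseudoFrobSet S S') (h2 : w + w ∉ S) : w + w ∈ pseudoFrobSet S S' := by
  refine ⟨S'.add_mem hw.1 hw.1, h2, fun s hs h0 => ?_⟩
  rw [add_assoc]
  exact hw.2.2 _ (hw.2.2 s hs h0) (by omega)

theorem IrreducibleIn.exists_pseudoFrobSet_eq {S S' : AddSubmonoid ℕ} (hSS' : S ≤ S')
    (hirr : IrreducibleIn S S') (hcard : (pseudoFrobSet S S').ncard = 2) :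
    ∃ w, pseudoFrobSet S S' = {w, w + w} := by
  obtain ⟨p, q, hpq, hPF⟩ := Set.ncard_eq_two.mp hcard
  have hp : p ∈ pseudoFrobSet S S' := hPF ▸ Or.inl rfl
  have hq : q ∈ pseudoFrobSet S S' := hPF ▸ Or.inr rfl
  have hne : ∀ {u : ℕ}, u ∈ pseudoFrobSet S S' → u + u ≠ u := fun hu h =>
    hu.2.1 (add_eq_left.mp h ▸ S.zero_mem)
  by_cases hp2 : p + p ∈ S
  · by_cases hq2 : q + q ∈ S
    · exact (hpq (hirr.eq_of_mem_pseudoFrobSet hSS' hp hq hp2 hq2)).elim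
    · have h := add_self_mem_pseudoFrobSet hq hq2
      rw [hPF] at h
      obtain h | h := h
      · exact ⟨q, by rw [hPF, h, Set.pair_comm]⟩
      · exact (hne hq h).elim
  · have h := add_self_mem_pseudoFrobSet hp hp2
    rw [hPF] at h
    obtain h | h := h
    · exact (hne hp h).elim
    · exact ⟨p, by rw [hPF, h]⟩

theorem card_gapSet_of_pseudoFrobSet_eq_singleton {S S' : AddSubmonoid ℕ} (hSS' : S ≤ S')
    (hfin : (gapSet S S').Finite) {F : ℕ} (hPF : pseudoFrobSet S S' = {F}) :
    (gapSet S S').ncard = (sporadicSet S S').ncard := by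
  have hF : F ∈ pseudoFrobSet S S' := hPF ▸ rfl
  have hG : ∀ g ∈ gapSet S S', ∃ s ∈ S, g + s = F := fun g hg => by
    simpa only [hPF, Set.mem_singleton_iff] using exists_add_mem_pseudoFrobSet hSS' hfin hg
  rw [← ncard_sep_gapSet_eq_ncard_sporadicSet hF.2.1, Set.sep_eq_self_iff_mem_true.mpr hG]
  rintro a ⟨ha, t, ht, hat⟩
  obtain ⟨s, hs, rfl⟩ := hG (a + t) ⟨S'.add_mem (hSS' ha) ht, hat⟩
  exact ⟨t + s, S'.add_mem ht (hSS' hs), (add_assoc a t s).symm⟩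

theorem card_gapSet_of_pseudoFrobSet_eq_pair {S S' : AddSubmonoid ℕ} (hSS' : S ≤ S')
    (hfin : (gapSet S S').Finite) {w : ℕ} (hPF : pseudoFrobSet S S' = {w, w + w}) :
    (gapSet S S').ncard = (sporadicSet S S').ncard + 1 := by
  have hw : w ∈ pseudoFrobSet S S' := hPF ▸ Or.inl rfl
  have hF : w + w ∈ pseudoFrobSet S S' := hPF ▸ Or.inr rfl
  have hG : ∀ g ∈ gapSet S S', g ≠ w → ∃ s ∈ S, g + s = w + w := fun g hg hgw => by
    obtain ⟨s, hs, h⟩ := exists_add_mem_pseudoFrobSet hSS' hfin hg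
    rw [hPF] at h
    obtain h | h := h
    · exact ⟨w + s, hw.2.2 s hs (by omega), by omega⟩
    · exact ⟨s, hs, h⟩
  have hsep : {g ∈ gapSet S S' | ∃ s ∈ S, g + s = w + w} = gapSet S S' \ {w} := by
    ext g
    refine ⟨fun ⟨hg, s, hs, h⟩ => ⟨hg, fun hgw => hw.2.1 ?_⟩, fun ⟨hg, hgw⟩ => ⟨hg, hG g hg hgw⟩⟩
    obtain rfl : g = w := hgw
    rwa [← Nat.add_left_cancel h]
  rw [← ncard_sep_gapSet_eq_ncard_sporadicSet hF.2.1, hsep]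
  · exact (Set.ncard_sdiff_singleton_add_one (show w ∈ gapSet S S' from ⟨hw.1, hw.2.1⟩) hfin).symm
  rintro a ⟨ha, t, ht, hat⟩
  by_cases hatw : a + t = w
  · exact ⟨t + w, S'.add_mem ht hw.1, by omega⟩
  · obtain ⟨s, hs, h⟩ := hG (a + t) ⟨S'.add_mem (hSS' ha) ht, hat⟩ hatw
    exact ⟨t + s, S'.add_mem ht (hSS' hs), by omega⟩

theorem irreducible_card_gaps (S S' : AddSubmonoid ℕ) (hSS' : S ≤ S') (hne : S ≠ S')
    (hgcd : EquiGcd S S') (hirr : IrreducibleIn S S') :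
    (Nat.card (pseudoFrobSet S S') = 1 →
      Nat.card (gapSet S S') = Nat.card (sporadicSet S S')) ∧
    (Nat.card (pseudoFrobSet S S') = 2 →
      Nat.card (gapSet S S') = Nat.card (sporadicSet S S') + 1) := by
  simp only [Nat.card_coe_set_eq]
  have hfin := finite_gapSet hgcd
  refine ⟨fun h => ?_, fun h => ?_⟩
  · obtain ⟨F, hPF⟩ := Set.ncard_eq_one.mp h
    exact card_gapSet_of_pseudoFrobSet_eq_singleton hSS' hfin hPF
  · obtain ⟨w, hPF⟩ := hirr.exists_pseudoFrobSet_eq hSS' h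
    exact card_gapSet_of_pseudoFrobSet_eq_pair hSS' hfin hPF
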